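/- arXiv:2605.26780 — 3 statements merged into one kernel-verified Lean document; each statement's English description precedes it below -/
import Mathlib

section
/- One has 3∫₀^{2π} ρ(θ)² dθ + (32π − 38)A + (π − 1)∫₀^{2π} ρ_β(θ)² dθ ≥ ((8π − 8)/π)L² + (8 − 2π)|Ã|. Moreover, equality holds if there exist real numbers a₀, a₁, b₁ with p(θ) = a₀ + a₁ cos θ + b₁ sin θ for all θ (i.e. if K is a disk). -/
open MeasureTheory

noncomputable section

lemma aux_pos : (0:ℝ) < 2 * Real.pi := by positivity

def auxSq (f : ℝ → ℝ) (n : ℤ) : ℝ := ‖fourierCoeffOn aux_pos (fun x => (f x : ℂ)) n‖ ^ 2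

lemma aux_pars (f : ℝ → ℝ) (hf : Continuous f) :
    HasSum (auxSq f) ((2 * Real.pi)⁻¹ * ∫ x in (0:ℝ)..(2 * Real.pi), f x ^ 2) := by
  have hc : Continuous (fun x => (f x : ℂ)) := by fun_prop
  have hL : MemLp (fun x => (f x : ℂ)) 2 (volume.restrict (Set.Ioc 0 (2 * Real.pi))) := by
    rw [memLp_two_iff_integrable_sq_norm hc.aestronglyMeasurable]
    exact (hc.norm.pow 2).integrableOn_Ioc
  have h := hasSum_sq_fourierCoeffOn aux_pos hL
  have hh : auxSq f = fun i => ‖fourierCoeffOn aux_pos (fun x => (f x : ℂ)) i‖ ^ 2 := rfl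
  rw [hh]
  simpa using h

lemma aux_zero (f : ℝ → ℝ) :
    auxSq f 0 = ((2 * Real.pi)⁻¹ * ∫ x in (0:ℝ)..(2 * Real.pi), f x) ^ 2 := by
  unfold auxSq
  rw [fourierCoeffOn_eq_integral]
  have : ∀ x : ℝ, fourier (-0) (x : AddCircle (2 * Real.pi - 0)) • (f x : ℂ) = (f x : ℂ) := by
    intro x; simp
  simp_rw [this]
  rw [intervalIntegral.integral_ofReal, Complex.real_smul, ← Complex.ofReal_mul, Complex.norm_real,
    Real.norm_eq_abs, sq_abs]
  simp

lemma aux_int (f f' : ℝ → ℝ) (hf : ∀ x, HasDerivAt f (f' x) x) (hc : Continuous f')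
    (hp : f (2 * Real.pi) = f 0) : ∫ x in (0:ℝ)..(2 * Real.pi), f' x = 0 := by
  rw [intervalIntegral.integral_eq_sub_of_hasDerivAt (fun x _ => hf x)
    (hc.intervalIntegrable _ _), hp, sub_self]

lemma aux_der (f f' : ℝ → ℝ) (hf : ∀ x, HasDerivAt f (f' x) x) (hc : Continuous f')
    (hp : f (2 * Real.pi) = f 0) (n : ℤ) : auxSq f' n = (n:ℝ) ^ 2 * auxSq f n := by
  by_cases hn : n = 0
  · subst hn
    rw [aux_zero, aux_int f f' hf hc hp]; simp
  · have h := fourierCoeffOn_of_hasDerivAt aux_pos (f := fun x => (f x : ℂ))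
      (f' := fun x => (f' x : ℂ)) hn (fun x _ => (hf x).ofReal_comp)
      ((Complex.continuous_ofReal.comp hc).intervalIntegrable _ _)
    simp only [hp, sub_self, mul_zero, zero_sub] at h
    have hn' : (n : ℂ) ≠ 0 := by exact_mod_cast hn
    have hpi : (Real.pi : ℂ) ≠ 0 := by exact_mod_cast Real.pi_ne_zero
    have h2 : fourierCoeffOn aux_pos (fun x => (f' x : ℂ)) n
        = Complex.I * n * fourierCoeffOn aux_pos (fun x => (f x : ℂ)) n := by
      rw [h]
      push_cast
      field_simp
      ring
    unfold auxSq
    rw [h2, norm_mul, norm_mul, Complex.norm_I, Complex.norm_intCast, one_mul, mul_pow, sq_abs]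

lemma aux_ibp (f f' g g' : ℝ → ℝ) (hf : ∀ x, HasDerivAt f (f' x) x) (hc : Continuous f')
    (hg : ∀ x, HasDerivAt g (g' x) x) (hcg : Continuous g')
    (hp : f (2 * Real.pi) = f 0) (hq : g (2 * Real.pi) = g 0) :
    ∫ x in (0:ℝ)..(2 * Real.pi), f x * g' x = - ∫ x in (0:ℝ)..(2 * Real.pi), f' x * g x := by
  rw [intervalIntegral.integral_mul_deriv_eq_deriv_mul (fun x _ => hf x) (fun x _ => hg x)
    (hc.intervalIntegrable _ _) (hcg.intervalIntegrable _ _), hp, hq]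
  ring

lemma aux_ineq (p p1 p2 p3 : ℝ → ℝ) (h0 : ∀ x, HasDerivAt p (p1 x) x)
    (h1 : ∀ x, HasDerivAt p1 (p2 x) x) (h2 : ∀ x, HasDerivAt p2 (p3 x) x)
    (c0 : Continuous p) (c1 : Continuous p1) (c2 : Continuous p2) (c3 : Continuous p3)
    (e0 : p (2 * Real.pi) = p 0) (e1 : p1 (2 * Real.pi) = p1 0) (e2 : p2 (2 * Real.pi) = p2 0) :
    (∫ x in (0:ℝ)..(2 * Real.pi), p1 x ^ 2) ≤ ∫ x in (0:ℝ)..(2 * Real.pi), p2 x ^ 2 := by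
  have k1 := aux_pars p1 c1
  have k2 := aux_pars p2 c2
  have := hasSum_le (fun n => ?_) k1 k2
  · exact le_of_mul_le_mul_left this (inv_pos.2 aux_pos)
  · rw [aux_der p1 p2 h1 c2 e1, aux_der p p1 h0 c1 e0]
    have hs : 0 ≤ auxSq p n := by unfold auxSq; positivity
    have hn : (n:ℝ)^2 * ((n:ℝ)^2 - 1) ≥ 0 := by
      rcases eq_or_ne n 0 with rfl | hn
      · simp
      · have : (1:ℝ) ≤ (n:ℝ)^2 := by
          have : 1 ≤ n^2 := Int.add_one_le_of_lt (by positivity : 0 < n ^ 2)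
          exact_mod_cast this
        exact mul_nonneg (by positivity) (by linarith)
    nlinarith [mul_nonneg hn hs]

lemma aux_main (p p1 p2 p3 : ℝ → ℝ) (h0 : ∀ x, HasDerivAt p (p1 x) x)
    (h1 : ∀ x, HasDerivAt p1 (p2 x) x) (h2 : ∀ x, HasDerivAt p2 (p3 x) x)
    (c0 : Continuous p) (c1 : Continuous p1) (c2 : Continuous p2) (c3 : Continuous p3)
    (e0 : p (2 * Real.pi) = p 0) (e1 : p1 (2 * Real.pi) = p1 0) (e2 : p2 (2 * Real.pi) = p2 0) :
    0 ≤ (∫ x in (0:ℝ)..(2 * Real.pi), p3 x ^ 2) - (∫ x in (0:ℝ)..(2 * Real.pi), p2 x ^ 2)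
      - 16 * (∫ x in (0:ℝ)..(2 * Real.pi), p1 x ^ 2)
      + 16 * ((∫ x in (0:ℝ)..(2 * Real.pi), p x ^ 2)
        - (2 * Real.pi)⁻¹ * (∫ x in (0:ℝ)..(2 * Real.pi), p x) ^ 2) := by
  have k := ((((aux_pars p3 c3).sub (aux_pars p2 c2)).sub ((aux_pars p1 c1).mul_left 16)).add
    ((aux_pars p c0).mul_left 16))
  have k' := k.sub ((hasSum_ite_eq (0:ℤ) (auxSq p 0)).mul_left 16)
  have := hasSum_le (fun n => ?_) (hasSum_zero (β := ℤ) (α := ℝ)) k'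
  · rw [aux_zero] at this
    have hpi := aux_pos
    have h3 := mul_nonneg hpi.le this
    refine h3.trans_eq ?_
    field_simp
    ring
  · rw [aux_der p2 p3 h2 c3 e2, aux_der p1 p2 h1 c2 e1, aux_der p p1 h0 c1 e0]
    have hs : 0 ≤ auxSq p n := by unfold auxSq; positivity
    split_ifs with hn
    · subst hn; simp
    · have hq : 0 ≤ (((n:ℝ)^2-1)*((n:ℝ)^2 - 4)) * ((n:ℝ)^2+4) := by
        refine mul_nonneg ?_ (by positivity)
        have h1 : 1 ≤ n^2 := Int.add_one_le_of_lt (by positivity : 0 < n ^ 2)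
        rcases h1.eq_or_lt with h | h
        · have : (1:ℝ) = (n:ℝ)^2 := by exact_mod_cast h
          rw [← this]; simp
        · have : 4 ≤ n^2 := by
            have : 1 < |n| := by
              by_contra hh
              have : |n|^2 ≤ 1 := by nlinarith [abs_nonneg n]
              rw [sq_abs] at this; omega
            rw [← sq_abs]; nlinarith
          have h4 : (4:ℝ) ≤ (n:ℝ)^2 := by exact_mod_cast this
          exact mul_nonneg (by linarith) (by linarith)
      have := mul_nonneg hq hs
      nlinarith [this]

theorem stmt16
    (p : ℝ → ℝ)
    (hp : ContDiff ℝ (⊤ : ℕ∞) p)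
    (hper : ∀ θ : ℝ, p (θ + 2 * Real.pi) = p θ)
    (ρ : ℝ → ℝ)
    (hρdef : ρ = fun θ => p θ + iteratedDeriv 2 p θ)
    (hρpos : ∀ θ : ℝ, 0 < ρ θ)
    (L A : ℝ)
    (hL : L = ∫ θ in (0:ℝ)..(2 * Real.pi), ρ θ)
    (hA : A = (1 / 2) * ∫ θ in (0:ℝ)..(2 * Real.pi), (p θ ^ 2 - deriv p θ ^ 2))
    (Atilde : ℝ)
    (hAt : Atilde = (1 / 2) * ∫ θ in (0:ℝ)..(2 * Real.pi), (deriv p θ ^ 2 - iteratedDeriv 2 p θ ^ 2))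
    (ρβ : ℝ → ℝ)
    (hρβ : ρβ = fun θ => |deriv p θ + iteratedDeriv 3 p θ|)
    :
    ((8 * Real.pi - 8) / Real.pi) * L ^ 2 + (8 - 2 * Real.pi) * |Atilde|
        ≤ 3 * (∫ θ in (0:ℝ)..(2 * Real.pi), ρ θ ^ 2) + (32 * Real.pi - 38) * A
          + (Real.pi - 1) * (∫ θ in (0:ℝ)..(2 * Real.pi), ρβ θ ^ 2) ∧
      ((∃ a₀ a₁ b₁ : ℝ, ∀ θ : ℝ, p θ = a₀ + a₁ * Real.cos θ + b₁ * Real.sin θ) →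
        ((8 * Real.pi - 8) / Real.pi) * L ^ 2 + (8 - 2 * Real.pi) * |Atilde|
          = 3 * (∫ θ in (0:ℝ)..(2 * Real.pi), ρ θ ^ 2) + (32 * Real.pi - 38) * A
            + (Real.pi - 1) * (∫ θ in (0:ℝ)..(2 * Real.pi), ρβ θ ^ 2)) := by
  have d1 : ContDiff ℝ (⊤ : ℕ∞) (deriv p) := (contDiff_infty_iff_deriv.1 hp).2
  have d2 : ContDiff ℝ (⊤ : ℕ∞) (deriv (deriv p)) := (contDiff_infty_iff_deriv.1 d1).2
  have d3 : ContDiff ℝ (⊤ : ℕ∞) (deriv (deriv (deriv p))) := (contDiff_infty_iff_deriv.1 d2).2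
  have i2 : iteratedDeriv 2 p = deriv (deriv p) := by
    rw [iteratedDeriv_succ, iteratedDeriv_one]
  have i3 : iteratedDeriv 3 p = deriv (deriv (deriv p)) := by
    rw [iteratedDeriv_succ, i2]
  have hd : ∀ f : ℝ → ℝ, (∀ θ, f (θ + 2 * Real.pi) = f θ) →
      ∀ θ, deriv f (θ + 2 * Real.pi) = deriv f θ := by
    intro f hf θ
    rw [← deriv_comp_add_const]
    congr 1
    funext x
    exact hf x
  have q1 := hd _ hper
  have q2 := hd _ q1
  rw [i2] at hρdef hAt
  rw [i3] at hρβ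
  have h0 : ∀ x, HasDerivAt p (deriv p x) x :=
    fun x => ((contDiff_infty_iff_deriv.1 hp).1 x).hasDerivAt
  have h1 : ∀ x, HasDerivAt (deriv p) (deriv (deriv p) x) x :=
    fun x => ((contDiff_infty_iff_deriv.1 d1).1 x).hasDerivAt
  have h2 : ∀ x, HasDerivAt (deriv (deriv p)) (deriv (deriv (deriv p)) x) x :=
    fun x => ((contDiff_infty_iff_deriv.1 d2).1 x).hasDerivAt
  have c0 := hp.continuous
  have c1 := d1.continuous
  have c2 := d2.continuous
  have c3 := d3.continuous
  have e0 : p (2 * Real.pi) = p 0 := by simpa using hper 0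
  have e1 : deriv p (2 * Real.pi) = deriv p 0 := by simpa using q1 0
  have e2 : deriv (deriv p) (2 * Real.pi) = deriv (deriv p) 0 := by simpa using q2 0
  clear i2 i3 hd d1 d2 d3 q1 q2
  have eqcase : (∃ a₀ a₁ b₁ : ℝ, ∀ θ : ℝ, p θ = a₀ + a₁ * Real.cos θ + b₁ * Real.sin θ) →
      ∃ a : ℝ, (∀ x, deriv (deriv p) x = a - p x) ∧ ∀ x, deriv (deriv (deriv p)) x = - deriv p x := by
    rintro ⟨a, b, c, h⟩
    have hpf : p = fun θ => a + b * Real.cos θ + c * Real.sin θ := funext h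
    have g1 : deriv p = fun θ => - b * Real.sin θ + c * Real.cos θ := by
      funext x
      have := (((Real.hasDerivAt_cos x).const_mul b).const_add a).add
        ((Real.hasDerivAt_sin x).const_mul c)
      rw [hpf]
      refine (HasDerivAt.deriv (this.congr_deriv ?_))
      ring
    have g2 : deriv (deriv p) = fun θ => a - p θ := by
      funext x
      have := ((Real.hasDerivAt_sin x).const_mul (-b)).add
        ((Real.hasDerivAt_cos x).const_mul c)
      rw [g1]
      refine (HasDerivAt.deriv (this.congr_deriv ?_))
      rw [h x]
      ring
    refine ⟨a, fun x => congrFun g2 x, fun x => ?_⟩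
    rw [g2]
    simp
  generalize deriv (deriv (deriv p)) = p3 at *
  generalize deriv (deriv p) = p2 at *
  generalize deriv p = p1 at *
  have m1 := aux_ineq p p1 p2 p3 h0 h1 h2 c0 c1 c2 c3 e0 e1 e2
  have m2 := aux_main p p1 p2 p3 h0 h1 h2 c0 c1 c2 c3 e0 e1 e2
  have b1 := aux_ibp p p1 p1 p2 h0 c1 h1 c2 e0 e1
  have b2 := aux_ibp p1 p2 p2 p3 h1 c2 h2 c3 e1 e2
  have z2 := aux_int p1 p2 h1 c2 e1
  simp_rw [← pow_two] at b1 b2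
  have ii : ∀ f : ℝ → ℝ, Continuous f → IntervalIntegrable f volume 0 (2 * Real.pi) :=
    fun f hf => hf.intervalIntegrable _ _
  have rL : L = ∫ x in (0:ℝ)..(2 * Real.pi), p x := by
    rw [hL, hρdef, intervalIntegral.integral_add (ii _ c0) (ii _ c2), z2, add_zero]
  rw [intervalIntegral.integral_sub (ii _ (by fun_prop)) (ii _ (by fun_prop))] at hA hAt
  have rρ : (∫ θ in (0:ℝ)..(2 * Real.pi), ρ θ ^ 2) =
      (∫ x in (0:ℝ)..(2 * Real.pi), p x ^ 2) + 2 * (∫ x in (0:ℝ)..(2 * Real.pi), p x * p2 x)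
        + ∫ x in (0:ℝ)..(2 * Real.pi), p2 x ^ 2 := by
    rw [← intervalIntegral.integral_const_mul,
      ← intervalIntegral.integral_add (ii _ (by fun_prop)) (ii _ (by fun_prop)),
      ← intervalIntegral.integral_add (ii _ (by fun_prop)) (ii _ (by fun_prop)), hρdef]
    congr 1; funext x; ring
  have rβ : (∫ θ in (0:ℝ)..(2 * Real.pi), ρβ θ ^ 2) =
      (∫ x in (0:ℝ)..(2 * Real.pi), p1 x ^ 2) + 2 * (∫ x in (0:ℝ)..(2 * Real.pi), p1 x * p3 x)
        + ∫ x in (0:ℝ)..(2 * Real.pi), p3 x ^ 2 := by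
    rw [← intervalIntegral.integral_const_mul,
      ← intervalIntegral.integral_add (ii _ (by fun_prop)) (ii _ (by fun_prop)),
      ← intervalIntegral.integral_add (ii _ (by fun_prop)) (ii _ (by fun_prop)), hρβ]
    congr 1; funext x; rw [sq_abs]; ring
  have hAbs : |Atilde| = - Atilde := abs_of_nonpos (by rw [hAt]; linarith)
  have key : 3 * (∫ θ in (0:ℝ)..(2 * Real.pi), ρ θ ^ 2) + (32 * Real.pi - 38) * A
          + (Real.pi - 1) * (∫ θ in (0:ℝ)..(2 * Real.pi), ρβ θ ^ 2) -
      (((8 * Real.pi - 8) / Real.pi) * L ^ 2 + (8 - 2 * Real.pi) * |Atilde|) =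
      (Real.pi - 1) * ((∫ x in (0:ℝ)..(2 * Real.pi), p3 x ^ 2)
        - (∫ x in (0:ℝ)..(2 * Real.pi), p2 x ^ 2)
      - 16 * (∫ x in (0:ℝ)..(2 * Real.pi), p1 x ^ 2)
      + 16 * ((∫ x in (0:ℝ)..(2 * Real.pi), p x ^ 2)
        - (2 * Real.pi)⁻¹ * (∫ x in (0:ℝ)..(2 * Real.pi), p x) ^ 2)) := by
    rw [rρ, rβ, hAbs, hAt, hA, rL, b1, b2]
    have := Real.pi_ne_zero
    field_simp
    ring
  refine ⟨?_, fun he => ?_⟩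
  · have := mul_nonneg (by linarith [Real.pi_gt_three] : 0 ≤ Real.pi - 1) m2
    linarith
  · obtain ⟨a, ha, hb⟩ := eqcase he
    have s3 : (∫ x in (0:ℝ)..(2 * Real.pi), p3 x ^ 2)
        = ∫ x in (0:ℝ)..(2 * Real.pi), p1 x ^ 2 := by simp_rw [hb, neg_sq]
    have s2 : (∫ x in (0:ℝ)..(2 * Real.pi), p1 x ^ 2)
        = ∫ x in (0:ℝ)..(2 * Real.pi), p2 x ^ 2 := by
      have : (∫ x in (0:ℝ)..(2 * Real.pi), p1 x * p3 x)
        = - ∫ x in (0:ℝ)..(2 * Real.pi), p1 x ^ 2 := by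
        rw [← intervalIntegral.integral_neg]
        congr 1; funext x; rw [hb]; ring
      linarith
    have s0 : (∫ x in (0:ℝ)..(2 * Real.pi), p x) = 2 * Real.pi * a := by
      simp_rw [ha] at z2
      rw [intervalIntegral.integral_sub (ii _ (by fun_prop)) (ii _ c0),
        intervalIntegral.integral_const] at z2
      simp only [sub_zero, smul_eq_mul] at z2
      linarith
    have s1 : (∫ x in (0:ℝ)..(2 * Real.pi), p x * p2 x)
        = a * (∫ x in (0:ℝ)..(2 * Real.pi), p x) - ∫ x in (0:ℝ)..(2 * Real.pi), p x ^ 2 := by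
      rw [← intervalIntegral.integral_const_mul,
        ← intervalIntegral.integral_sub (ii _ (by fun_prop)) (ii _ (by fun_prop))]
      congr 1; funext x; rw [ha]; ring
    rw [s1, s0] at b1
    have hz : (∫ x in (0:ℝ)..(2 * Real.pi), p x ^ 2)
        = (∫ x in (0:ℝ)..(2 * Real.pi), p1 x ^ 2) + a * (2 * Real.pi * a) := by linarith
    have fin : (2 * Real.pi)⁻¹ * (2 * Real.pi * a) ^ 2 = a * (2 * Real.pi * a) := by
      have := Real.pi_ne_zero
      field_simp
    rw [s0, fin, hz, s3, ← s2] at key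
    have : (Real.pi - 1) * ((∫ x in (0:ℝ)..(2 * Real.pi), p1 x ^ 2)
        - (∫ x in (0:ℝ)..(2 * Real.pi), p1 x ^ 2)
      - 16 * (∫ x in (0:ℝ)..(2 * Real.pi), p1 x ^ 2)
      + 16 * ((∫ x in (0:ℝ)..(2 * Real.pi), p1 x ^ 2) + a * (2 * Real.pi * a)
        - a * (2 * Real.pi * a))) = 0 := by ring
    linarith
end
end

section
/- One has ∫₀^{2π} ρ(θ)² dθ + (52π/7 − 2)A + (3/4)∫₀^{2π} ρ_β(θ)² dθ ≥ (13/7)L² + (π/7)|Ã|. Moreover, equality holds if there exist real numbers a₀, a₁, b₁ with p(θ) = a₀ + a₁ cos θ + b₁ sin θ for all θ (i.e. if K is a disk). -/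
open MeasureTheory

noncomputable section

def FC (f : ℝ → ℝ) (n : ℤ) : ℂ := fourierCoeffOn Real.two_pi_pos (fun x => (f x : ℂ)) n

lemma FC_add {f g : ℝ → ℝ} (hf : Continuous f) (hg : Continuous g) (n : ℤ) :
    FC (fun x => f x + g x) n = FC f n + FC g n := by
  unfold FC
  simp only [fourierCoeffOn_eq_integral]
  rw [← smul_add, ← intervalIntegral.integral_add]
  · congr 1
    apply intervalIntegral.integral_congr
    intro x _
    simp only [smul_eq_mul]
    push_cast
    ring
  all_goals
    apply Continuous.intervalIntegrable
    simp only [smul_eq_mul]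
    apply Continuous.mul
    · exact (map_continuous (fourier (-n))).comp (AddCircle.continuous_mk' _)
    · fun_prop

lemma FC_zero (f : ℝ → ℝ) :
    FC f 0 = (((2 * Real.pi)⁻¹ * ∫ x in (0:ℝ)..(2 * Real.pi), f x : ℝ) : ℂ) := by
  unfold FC
  rw [fourierCoeffOn_eq_integral]
  simp [intervalIntegral.integral_ofReal]

lemma FC_deriv {f f' : ℝ → ℝ} (hf : ∀ x, HasDerivAt f (f' x) x) (hf' : Continuous f')
    (hper : f (2 * Real.pi) = f 0) (n : ℤ) : FC f' n = Complex.I * n * FC f n := by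
  by_cases hn : n = 0
  · subst hn
    rw [FC_zero, intervalIntegral.integral_eq_sub_of_hasDerivAt (fun x _ => hf x)
      (hf'.intervalIntegrable _ _), hper]
    simp
  · have h := fourierCoeffOn_of_hasDerivAt Real.two_pi_pos (f := fun x => (f x : ℂ))
      (f' := fun x => (f' x : ℂ)) hn (fun x _ => (hf x).ofReal_comp)
      ((Complex.continuous_ofReal.comp hf').intervalIntegrable _ _)
    unfold FC
    rw [h, hper]
    have hn' : (n : ℂ) ≠ 0 := by exact_mod_cast hn
    have hpi : (Real.pi : ℂ) ≠ 0 := by exact_mod_cast Real.pi_ne_zero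
    have hI := Complex.I_ne_zero
    push_cast
    field_simp
    ring

lemma FC_parseval {f : ℝ → ℝ} (hf : Continuous f) :
    HasSum (fun n => ‖FC f n‖ ^ 2) ((2 * Real.pi)⁻¹ * ∫ x in (0:ℝ)..(2 * Real.pi), f x ^ 2) := by
  have hc : Continuous (fun x => (f x : ℂ)) := Complex.continuous_ofReal.comp hf
  obtain ⟨C, hC⟩ := (isCompact_Icc (a := (0:ℝ)) (b := 2 * Real.pi)).exists_bound_of_continuousOn
    hc.continuousOn
  have hm : MemLp (fun x => (f x : ℂ)) 2 (volume.restrict (Set.Ioc 0 (2 * Real.pi))) := by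
    refine MemLp.of_bound hc.aestronglyMeasurable C ?_
    filter_upwards [ae_restrict_mem measurableSet_Ioc] with x hx
    exact hC x (Set.Ioc_subset_Icc_self hx)
  have h := hasSum_sq_fourierCoeffOn (f := fun x => (f x : ℂ)) Real.two_pi_pos hm
  simpa [FC] using h

lemma weight_nonneg (m : ℝ) (hm : m = 1 ∨ 4 ≤ m) :
    0 ≤ (1 - m) ^ 2 + (26 * Real.pi / 7 - 1) * (1 - m) + 3 / 4 * (m * (1 - m) ^ 2)
      + Real.pi / 14 * (m - m ^ 2) := by
  have h1 := Real.pi_lt_d2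
  have h0 := Real.pi_gt_three
  rcases hm with rfl | hm
  · norm_num
  · have : (1 - m) ^ 2 + (26 * Real.pi / 7 - 1) * (1 - m) + 3 / 4 * (m * (1 - m) ^ 2)
      + Real.pi / 14 * (m - m ^ 2) = (m - 1) * ((m - 4) * (3 / 4 * m + (13 / 4 - Real.pi / 14))
        + (13 - 4 * Real.pi)) := by ring
    rw [this]
    apply mul_nonneg (by linarith)
    apply add_nonneg _ (by linarith)
    apply mul_nonneg (by linarith) (by linarith)

lemma int_sq_cases (n : ℤ) (hn : n ≠ 0) : ((n : ℝ) ^ 2 = 1 ∨ 4 ≤ (n : ℝ) ^ 2) := by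
  have : n ^ 2 = 1 ∨ 4 ≤ n ^ 2 := by
    by_cases h : n = 1 ∨ n = -1
    · left; rcases h with rfl | rfl <;> norm_num
    · right
      have : 2 ≤ n ∨ n ≤ -2 := by omega
      rcases this with h | h <;> nlinarith
  exact_mod_cast this

theorem stmt17
    (p : ℝ → ℝ)
    (hp : ContDiff ℝ (⊤ : ℕ∞) p)
    (hper : ∀ θ : ℝ, p (θ + 2 * Real.pi) = p θ)
    (ρ : ℝ → ℝ)
    (hρdef : ρ = fun θ => p θ + iteratedDeriv 2 p θ)
    (hρpos : ∀ θ : ℝ, 0 < ρ θ)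
    (L A : ℝ)
    (hL : L = ∫ θ in (0:ℝ)..(2 * Real.pi), ρ θ)
    (hA : A = (1 / 2) * ∫ θ in (0:ℝ)..(2 * Real.pi), (p θ ^ 2 - deriv p θ ^ 2))
    (Atilde : ℝ)
    (hAt : Atilde = (1 / 2) * ∫ θ in (0:ℝ)..(2 * Real.pi), (deriv p θ ^ 2 - iteratedDeriv 2 p θ ^ 2))
    (ρβ : ℝ → ℝ)
    (hρβ : ρβ = fun θ => |deriv p θ + iteratedDeriv 3 p θ|)
    :
    (13 / 7) * L ^ 2 + (Real.pi / 7) * |Atilde|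
        ≤ (∫ θ in (0:ℝ)..(2 * Real.pi), ρ θ ^ 2) + (52 * Real.pi / 7 - 2) * A
          + (3 / 4) * (∫ θ in (0:ℝ)..(2 * Real.pi), ρβ θ ^ 2) ∧
      ((∃ a₀ a₁ b₁ : ℝ, ∀ θ : ℝ, p θ = a₀ + a₁ * Real.cos θ + b₁ * Real.sin θ) →
        (13 / 7) * L ^ 2 + (Real.pi / 7) * |Atilde|
          = (∫ θ in (0:ℝ)..(2 * Real.pi), ρ θ ^ 2) + (52 * Real.pi / 7 - 2) * A
            + (3 / 4) * (∫ θ in (0:ℝ)..(2 * Real.pi), ρβ θ ^ 2)) := by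
  have hsm : ∀ k : ℕ, Continuous (iteratedDeriv k p) := fun k =>
    hp.continuous_iteratedDeriv k (by exact_mod_cast le_top)
  have hd : ∀ (k : ℕ) (x : ℝ), HasDerivAt (iteratedDeriv k p) (iteratedDeriv (k + 1) p x) x := by
    intro k x
    rw [iteratedDeriv_succ]
    exact ((hp.differentiable_iteratedDeriv k (by exact_mod_cast WithTop.coe_lt_top k)) x).hasDerivAt
  have hpk : ∀ (k : ℕ) (x : ℝ), iteratedDeriv k p (x + 2 * Real.pi) = iteratedDeriv k p x := by
    intro k x
    have h := congrFun (iteratedDeriv_comp_add_const k p (2 * Real.pi)) x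
    rw [← h]
    congr 1
    exact funext hper
  have hpk0 : ∀ k : ℕ, iteratedDeriv k p (2 * Real.pi) = iteratedDeriv k p 0 := by
    intro k
    simpa using hpk k 0
  have hF : ∀ (k : ℕ) (n : ℤ), FC (iteratedDeriv (k + 1) p) n
      = Complex.I * n * FC (iteratedDeriv k p) n :=
    fun k n => FC_deriv (hd k) (hsm (k + 1)) (hpk0 k) n
  have e0 : iteratedDeriv 0 p = p := iteratedDeriv_zero
  have e1 : iteratedDeriv 1 p = deriv p := iteratedDeriv_one
  have hF1 := hF 0
  have hF2 := hF 1
  have hF3 := hF 2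
  have hc0 := hsm 0
  have hc1 := hsm 1
  have hc2 := hsm 2
  have hc3 := hsm 3
  norm_num only at hF1 hF2 hF3
  rw [e0] at hF1 hc0
  rw [e1] at hF1 hF2 hc1
  have hII : ∀ z : ℂ, Complex.I * (Complex.I * z) = - z := by
    intro z; rw [← mul_assoc, Complex.I_mul_I]; ring
  set x : ℤ → ℝ := fun n => ‖FC p n‖ ^ 2 with hx
  have hx0 : ∀ n, 0 ≤ x n := fun n => sq_nonneg _
  have hρc : Continuous ρ := by rw [hρdef]; exact hc0.add hc2
  have hFρ : ∀ n, FC ρ n = ((1 - (n : ℝ) ^ 2 : ℝ) : ℂ) * FC p n := by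
    intro n
    rw [hρdef, FC_add hc0 hc2, hF2, hF1]
    push_cast
    linear_combination (n : ℂ) ^ 2 * FC p n * Complex.I_mul_I
  have hFβ : ∀ n, FC (fun θ => deriv p θ + iteratedDeriv 3 p θ) n
      = Complex.I * (((n : ℝ) * (1 - (n : ℝ) ^ 2) : ℝ) : ℂ) * FC p n := by
    intro n
    rw [FC_add hc1 hc3, hF3, hF2, hF1]
    push_cast
    linear_combination Complex.I * (n : ℂ) ^ 3 * FC p n * Complex.I_mul_I
  have hnr : ∀ r : ℝ, ‖(r : ℂ)‖ ^ 2 = r ^ 2 := by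
    intro r; rw [Complex.norm_real, Real.norm_eq_abs, sq_abs]
  have hnn : ∀ n : ℤ, ‖(n : ℂ)‖ ^ 2 = (n : ℝ) ^ 2 := by
    intro n; simpa using hnr n
  have S0 := FC_parseval hc0
  have S1 := FC_parseval hc1
  have S2 := FC_parseval hc2
  have Sρ := FC_parseval hρc
  have Sβ := FC_parseval (f := fun θ => deriv p θ + iteratedDeriv 3 p θ) (hc1.add hc3)
  have x1 : ∀ n, ‖FC (deriv p) n‖ ^ 2 = (n : ℝ) ^ 2 * x n := by
    intro n
    rw [hF1, norm_mul, norm_mul, mul_pow, mul_pow, hnn]; simp [hx]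
  have x2 : ∀ n, ‖FC (iteratedDeriv 2 p) n‖ ^ 2 = ((n : ℝ) ^ 2) ^ 2 * x n := by
    intro n
    rw [hF2, norm_mul, norm_mul, mul_pow, mul_pow, hnn, x1]; simp; ring
  have xρ : ∀ n, ‖FC ρ n‖ ^ 2 = (1 - (n : ℝ) ^ 2) ^ 2 * x n := by
    intro n
    rw [hFρ, norm_mul, mul_pow, hnr]
  have xβ : ∀ n, ‖FC (fun θ => deriv p θ + iteratedDeriv 3 p θ) n‖ ^ 2
      = (n : ℝ) ^ 2 * (1 - (n : ℝ) ^ 2) ^ 2 * x n := by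
    intro n
    rw [hFβ, norm_mul, norm_mul, mul_pow, mul_pow, hnr, Complex.norm_I]; ring
  simp only [x1] at S1
  simp only [x2] at S2
  simp only [xρ] at Sρ
  simp only [xβ] at Sβ
  have hLx : L = 2 * Real.pi * (2 * Real.pi)⁻¹ * L := by
    field_simp
  have hx00 : x 0 = ((2 * Real.pi)⁻¹ * L) ^ 2 := by
    have h1 := xρ 0
    rw [FC_zero, hnr, ← hL] at h1
    rw [h1]; simp
  have iA : A = 1 / 2 * ((∫ θ in (0:ℝ)..(2 * Real.pi), p θ ^ 2)
      - ∫ θ in (0:ℝ)..(2 * Real.pi), deriv p θ ^ 2) := by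
    rw [hA, intervalIntegral.integral_sub
      (Continuous.intervalIntegrable (by fun_prop) _ _)
      (Continuous.intervalIntegrable (by fun_prop) _ _)]
  have iAt : Atilde = 1 / 2 * ((∫ θ in (0:ℝ)..(2 * Real.pi), deriv p θ ^ 2)
      - ∫ θ in (0:ℝ)..(2 * Real.pi), iteratedDeriv 2 p θ ^ 2) := by
    rw [hAt, intervalIntegral.integral_sub
      (Continuous.intervalIntegrable (by fun_prop) _ _)
      (Continuous.intervalIntegrable (by fun_prop) _ _)]
  have iβ : (∫ θ in (0:ℝ)..(2 * Real.pi), ρβ θ ^ 2)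
      = ∫ θ in (0:ℝ)..(2 * Real.pi), (deriv p θ + iteratedDeriv 3 p θ) ^ 2 := by
    rw [hρβ]; simp only [sq_abs]
  rw [iβ]
  set I0 := ∫ θ in (0:ℝ)..(2 * Real.pi), p θ ^ 2
  set I1 := ∫ θ in (0:ℝ)..(2 * Real.pi), deriv p θ ^ 2
  set I2 := ∫ θ in (0:ℝ)..(2 * Real.pi), iteratedDeriv 2 p θ ^ 2
  set Iρ := ∫ θ in (0:ℝ)..(2 * Real.pi), ρ θ ^ 2
  set Iβ := ∫ θ in (0:ℝ)..(2 * Real.pi), (deriv p θ + iteratedDeriv 3 p θ) ^ 2 with hIβ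
  have hπ := Real.pi_pos
  have hc : 0 < (2 * Real.pi)⁻¹ := by positivity
  have hAtneg : Atilde ≤ 0 := by
    have h := (S2.sub S1).nonneg (fun n => by
      rcases eq_or_ne n 0 with rfl | hn
      · simp
      · have h1 : 1 ≤ (n : ℝ) ^ 2 := by rcases int_sq_cases n hn with h | h <;> linarith
        have : ((n : ℝ) ^ 2) ^ 2 * x n - (n : ℝ) ^ 2 * x n
          = (n : ℝ) ^ 2 * ((n : ℝ) ^ 2 - 1) * x n := by ring
        rw [this]
        exact mul_nonneg (mul_nonneg (by linarith) (by linarith)) (hx0 n))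
    rw [← mul_sub] at h
    have := nonneg_of_mul_nonneg_right h hc
    rw [iAt]; linarith
  rw [abs_of_nonpos hAtneg]
  have hS := ((((Sρ.add ((S0.sub S1).mul_left (26 * Real.pi / 7 - 1))).add
    (Sβ.mul_left (3 / 4))).add ((S1.sub S2).mul_left (Real.pi / 14))).sub
    (hasSum_ite_eq (0 : ℤ) (26 * Real.pi / 7 * x 0)))
  have hval : ∀ D : ℝ, D = Iρ + (52 * Real.pi / 7 - 2) * A + 3 / 4 * Iβ
      - (13 / 7 * L ^ 2 + Real.pi / 7 * -Atilde) → 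
    (2 * Real.pi)⁻¹ * Iρ + (26 * Real.pi / 7 - 1) * ((2 * Real.pi)⁻¹ * I0 - (2 * Real.pi)⁻¹ * I1)
      + 3 / 4 * ((2 * Real.pi)⁻¹ * Iβ)
      + Real.pi / 14 * ((2 * Real.pi)⁻¹ * I1 - (2 * Real.pi)⁻¹ * I2)
      - 26 * Real.pi / 7 * x 0 = (2 * Real.pi)⁻¹ * D := by
    intro D hD
    rw [hD, hx00, iA, iAt]
    field_simp
    ring
  have hval := hval _ rfl
  rw [hval] at hS
  constructor
  · have h := hS.nonneg (fun n => by
      rcases eq_or_ne n 0 with rfl | hn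
      · simp [hx]; ring_nf; rfl
      · have hw := mul_nonneg (weight_nonneg _ (int_sq_cases n hn)) (hx0 n)
        rw [if_neg hn]
        refine hw.trans_eq ?_
        simp only [hx]; ring)
    have := nonneg_of_mul_nonneg_right h hc
    linarith
  · rintro ⟨a₀, a₁, b₁, hpe⟩
    have hpe' : p = fun θ => a₀ + a₁ * Real.cos θ + b₁ * Real.sin θ := funext hpe
    have d1 : deriv p = fun θ => - a₁ * Real.sin θ + b₁ * Real.cos θ := by
      funext θ
      rw [hpe']
      have := (((Real.hasDerivAt_cos θ).const_mul a₁).const_add a₀).add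
        ((Real.hasDerivAt_sin θ).const_mul b₁)
      exact this.deriv.trans (by ring)
    have d2 : iteratedDeriv 2 p = fun θ => - a₁ * Real.cos θ - b₁ * Real.sin θ := by
      funext θ
      rw [iteratedDeriv_succ, e1, d1]
      have := ((Real.hasDerivAt_sin θ).const_mul (-a₁)).add
        ((Real.hasDerivAt_cos θ).const_mul b₁)
      exact this.deriv.trans (by ring)
    have d3 : iteratedDeriv 3 p = fun θ => a₁ * Real.sin θ - b₁ * Real.cos θ := by
      funext θ
      rw [iteratedDeriv_succ, d2]
      have := ((Real.hasDerivAt_cos θ).const_mul (-a₁)).sub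
        ((Real.hasDerivAt_sin θ).const_mul b₁)
      exact this.deriv.trans (by ring)
    have hβ0 : Iβ = 0 := by
      rw [hIβ, d1, d3]
      have : ∀ θ : ℝ, (-a₁ * Real.sin θ + b₁ * Real.cos θ
          + (a₁ * Real.sin θ - b₁ * Real.cos θ)) ^ 2 = 0 := fun θ => by ring
      simp only [this, intervalIntegral.integral_zero]
    rw [hβ0, mul_zero, hasSum_zero_iff_of_nonneg] at Sβ
    swap
    · intro n; exact mul_nonneg (by positivity) (hx0 n)
    have hz := hS.unique (a₂ := 0) (by
      convert hasSum_zero using 2 with n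
      have h := congrFun Sβ n
      rcases eq_or_ne n 0 with rfl | hn
      · simp [hx]; ring_nf
      · rw [if_neg hn]
        have hn' : (n : ℝ) ≠ 0 := by exact_mod_cast hn
        have h2 : (1 - (n : ℝ) ^ 2) = 0 ∨ x n = 0 := by
          simpa [hn'] using h
        have : ‖FC p n‖ ^ 2 = x n := rfl
        rw [this]
        rcases h2 with h2 | h2
        · have : (n : ℝ) ^ 2 = 1 := by linarith
          rw [this]; ring
        · rw [h2]; ring)
    have := (mul_eq_zero.mp hz).resolve_left hc.ne'
    rw [hβ0] at this ⊢
    linarith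
end
end

section
/- Let ε be a real number with 0 ≤ ε ≤ 1/2. Then |Ã| + ε∫₀^{2π} ρ_β(θ)² dθ + π(ρ_M − ρ_m)² ≥ 2π(ρ_e − ρ_i)², and equality holds if and only if K is a disk, i.e. there exist real numbers a₀, a₁, b₁ with p(θ) = a₀ + a₁ cos θ + b₁ sin θ for all θ. -/
open MeasureTheory

noncomputable section

lemma aux_hk (s : ℝ) : HasDerivAt (fun s : ℝ => s * Real.sin s + Real.cos s / 2 - 1)
    (Real.sin s / 2 + s * Real.cos s) s := by
  have := (((hasDerivAt_id s).mul (Real.hasDerivAt_sin s)).add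
    ((Real.hasDerivAt_cos s).div_const 2)).sub_const 1
  refine this.congr_deriv ?_
  simp only [id]; ring

lemma aux_hk' (s : ℝ) : HasDerivAt (fun s : ℝ => Real.sin s / 2 + s * Real.cos s)
    (3 / 2 * Real.cos s - s * Real.sin s) s := by
  have := ((Real.hasDerivAt_sin s).div_const 2).add
    ((hasDerivAt_id s).mul (Real.hasDerivAt_cos s))
  refine this.congr_deriv ?_
  simp only [id]; ring

lemma aux_int_k : ∫ s in (-Real.pi)..Real.pi, (s * Real.sin s + Real.cos s / 2 - 1) = 0 := by
  rw [intervalIntegral.integral_eq_sub_of_hasDerivAt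
    (f := fun s => Real.sin s - s * Real.cos s + Real.sin s / 2 - s)]
  · simp
  · intro s _
    have := (((Real.hasDerivAt_sin s).sub
      ((hasDerivAt_id s).mul (Real.hasDerivAt_cos s))).add
      ((Real.hasDerivAt_sin s).div_const 2)).sub (hasDerivAt_id s)
    refine this.congr_deriv ?_
    simp only [id]; ring
  · apply Continuous.intervalIntegrable; fun_prop

lemma aux_int_k2 : ∫ s in (-Real.pi)..Real.pi,
    ((s * Real.sin s + Real.cos s / 2 - 1) ^ 2 + 1 / 4)
      = Real.pi ^ 3 / 3 - 11 / 4 * Real.pi + Real.pi / 2 := by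
  rw [intervalIntegral.integral_eq_sub_of_hasDerivAt
    (f := fun s => s ^ 3 / 6 + 11 / 8 * s - s ^ 2 * (Real.sin s * Real.cos s) / 2
      - s * (1 - 2 * Real.sin s ^ 2) / 2 + 5 / 8 * (Real.sin s * Real.cos s)
      + 2 * (s * Real.cos s) - 3 * Real.sin s)]
  · simp; ring
  · intro s _
    have hs := Real.hasDerivAt_sin s
    have hc := Real.hasDerivAt_cos s
    have hi := hasDerivAt_id s
    have := (((((((hi.pow 3).div_const 6).add (hi.const_mul (11/8))).sub
      (((hi.pow 2).mul (hs.mul hc)).div_const 2)).sub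
      ((hi.mul (((hs.pow 2).const_mul 2).const_sub 1)).div_const 2)).add
      ((hs.mul hc).const_mul (5/8))).add ((hi.mul hc).const_mul 2)).sub (hs.const_mul 3)
    refine this.congr_deriv ?_
    simp
    have h := Real.sin_sq s
    ring_nf
    simp only [h]
    ring
  · apply Continuous.intervalIntegrable; fun_prop

lemma aux_polar (a b : ℝ) : ∃ θ : ℝ, a * Real.cos θ + b * Real.sin θ = √(a ^ 2 + b ^ 2) := by
  refine ⟨Complex.arg ⟨a, b⟩, ?_⟩
  have h1 := Complex.norm_mul_cos_arg ⟨a, b⟩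
  have h2 := Complex.norm_mul_sin_arg ⟨a, b⟩
  have h3 : ‖(⟨a, b⟩ : ℂ)‖ = √(a ^ 2 + b ^ 2) := by
    rw [Complex.norm_eq_sqrt_sq_add_sq]
  rw [h3] at h1 h2
  simp only at h1 h2
  set n := √(a ^ 2 + b ^ 2)
  set c := Real.cos (Complex.arg ⟨a, b⟩)
  set d := Real.sin (Complex.arg ⟨a, b⟩)
  have : d ^ 2 + c ^ 2 = 1 := Real.sin_sq_add_cos_sq _
  rw [← h1, ← h2]
  linear_combination n * this

lemma aux_cs (a b θ : ℝ) : a * Real.cos θ + b * Real.sin θ ≤ √(a ^ 2 + b ^ 2) := by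
  apply Real.le_sqrt_of_sq_le
  nlinarith [sq_nonneg (a * Real.sin θ - b * Real.cos θ), Real.sin_sq_add_cos_sq θ]

lemma aux_norm (x c : EuclideanSpace ℝ (Fin 2)) :
    dist x c = √((x 0 - c 0) ^ 2 + (x 1 - c 1) ^ 2) := by
  rw [EuclideanSpace.dist_eq]
  simp [Fin.sum_univ_two, Real.dist_eq, sq_abs]

lemma aux_ball (c c' : EuclideanSpace ℝ (Fin 2)) (r r' : ℝ) (hr : 0 ≤ r) (hr' : 0 ≤ r')
    (h : Metric.closedBall c r ⊆ Metric.closedBall c' r') : r ≤ r' := by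
  have h1 := Metric.diam_mono h Metric.isBounded_closedBall
  have h2 := Metric.diam_closedBall (x := c') hr'
  have h3 : Metric.diam (Metric.closedBall c r) = 2 * r := Metric.diam_closedBall_eq c hr
  linarith

/-- The geometric part. -/
lemma aux_geom (p : ℝ → ℝ) (K : Set (EuclideanSpace ℝ (Fin 2)))
    (hK : K = {x | ∀ θ : ℝ, x 0 * Real.cos θ + x 1 * Real.sin θ ≤ p θ})
    (ρe ρi : ℝ)
    (hρe : ρe = sInf {r : ℝ | 0 ≤ r ∧ ∃ c, K ⊆ Metric.closedBall c r})
    (hρi : ρi = sSup {r : ℝ | 0 ≤ r ∧ ∃ c, Metric.closedBall c r ⊆ K})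
    (a b m M : ℝ) (hM : 0 ≤ M)
    (h1 : ∀ θ, p θ - (a * Real.cos θ + b * Real.sin θ) ≤ M)
    (h2 : ∀ θ, m ≤ p θ - (a * Real.cos θ + b * Real.sin θ)) :
    0 ≤ ρe - ρi ∧ ρe - ρi ≤ M - m := by
  set c : EuclideanSpace ℝ (Fin 2) := !₂[a, b] with hc
  have c0 : c 0 = a := by simp [hc]
  have c1 : c 1 = b := by simp [hc]
  have hsub : K ⊆ Metric.closedBall c M := by
    intro x hx
    rw [hK] at hx
    rw [Metric.mem_closedBall, aux_norm, c0, c1]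
    obtain ⟨θ, hθ⟩ := aux_polar (x 0 - a) (x 1 - b)
    rw [← hθ]
    have := hx θ
    have := h1 θ
    nlinarith
  have hMem : M ∈ {r : ℝ | 0 ≤ r ∧ ∃ c, K ⊆ Metric.closedBall c r} := ⟨hM, c, hsub⟩
  have he : ρe ≤ M := by
    rw [hρe]; exact csInf_le ⟨0, fun r hr => hr.1⟩ hMem
  have hi : m ≤ ρi := by
    rw [hρi]
    rcases le_or_gt 0 m with hm | hm
    · refine le_csSup ⟨M, ?_⟩ ⟨hm, c, ?_⟩
      · rintro r ⟨hr, c', hc'⟩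
        exact aux_ball c' c r M hr hM (hc'.trans hsub)
      · intro x hx
        rw [Metric.mem_closedBall, aux_norm, c0, c1] at hx
        rw [hK]
        intro θ
        have := aux_cs (x 0 - a) (x 1 - b) θ
        have := h2 θ
        nlinarith
    · exact hm.le.trans (Real.sSup_nonneg fun r hr => hr.1)
  refine ⟨?_, by linarith⟩
  rw [sub_nonneg, hρe]
  refine le_csInf ⟨M, hMem⟩ ?_
  rintro r' ⟨hr', c', hc'⟩
  rw [hρi]
  refine Real.sSup_le ?_ hr'
  rintro r ⟨hr, c'', hc''⟩
  exact aux_ball c'' c' r r' hr hr' (hc''.trans hc')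

/-- The representation formula and the resulting estimate. -/
lemma aux_main_s18 (p p1 p2 : ℝ → ℝ) (hd1 : ∀ x, HasDerivAt p (p1 x) x)
    (hd2 : ∀ x, HasDerivAt p1 (p2 x) x) (hc2 : Continuous p2)
    (hper : ∀ θ : ℝ, p (θ + 2 * Real.pi) = p θ)
    (m M : ℝ) (hm : ∀ x, m ≤ p x + p2 x) (hM : ∀ x, p x + p2 x ≤ M)
    (hpos : ∀ x, 0 < p x + p2 x) :
    ∃ a0 a b : ℝ, 0 ≤ a0 ∧ ∀ θ, |p θ - (a * Real.cos θ + b * Real.sin θ) - a0| ≤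
      (M - m) / 2 * (27 / 50) := by
  have hcp : Continuous p := continuous_iff_continuousAt.2 fun x => (hd1 x).continuousAt
  have hcp1 : Continuous p1 := continuous_iff_continuousAt.2 fun x => (hd2 x).continuousAt
  have hper1 : ∀ θ, p1 (θ + 2 * Real.pi) = p1 θ := by
    intro θ
    have h := (hd1 (θ + 2 * Real.pi)).comp_add_const θ (2 * Real.pi)
    have h' : (fun x => p (x + 2 * Real.pi)) = p := funext hper
    rw [h'] at h
    exact h.unique (hd1 θ)
  have hpi := Real.pi_pos
  set I := ∫ s in (0:ℝ)..(2 * Real.pi), p s with hI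
  set A := ∫ s in (0:ℝ)..(2 * Real.pi), p s * Real.cos s with hA
  set B := ∫ s in (0:ℝ)..(2 * Real.pi), p s * Real.sin s with hB
  have hIpos : 0 ≤ I := by
    have e : (∫ s in (0:ℝ)..(2 * Real.pi), p2 s) = 0 := by
      rw [intervalIntegral.integral_eq_sub_of_hasDerivAt (fun x _ => hd2 x)
        (hc2.intervalIntegrable _ _)]
      have := hper1 0
      rw [zero_add] at this
      rw [this, sub_self]
    have e2 : (∫ s in (0:ℝ)..(2 * Real.pi), (p s + p2 s)) = I := by
      rw [intervalIntegral.integral_add (hcp.intervalIntegrable _ _)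
        (hc2.intervalIntegrable _ _), e, add_zero]
    rw [← e2]
    exact intervalIntegral.integral_nonneg (by positivity) fun x _ => (hpos x).le
  have key : ∀ x, (∫ s in (-Real.pi)..Real.pi,
      (s * Real.sin s + Real.cos s / 2 - 1) * (p (x + s) + p2 (x + s)))
      = 2 * Real.pi * p (x + Real.pi) + 2 * (A * Real.cos x + B * Real.sin x) - I := by
    intro x
    have e1 : (∫ s in (-Real.pi)..Real.pi, p (x + s)) = I := by
      rw [intervalIntegral.integral_comp_add_left (fun s => p s)]
      have h : Function.Periodic p (2 * Real.pi) := hper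
      have := h.intervalIntegral_add_eq (x + -Real.pi) 0
      rw [zero_add] at this
      rw [hI, ← this]
      congr 1; ring
    have e2 : (∫ s in (-Real.pi)..Real.pi, p (x + s) * Real.cos s)
        = A * Real.cos x + B * Real.sin x := by
      have h0 : (∫ s in (-Real.pi)..Real.pi, p (x + s) * Real.cos s) =
          ∫ s in (-Real.pi)..Real.pi, (fun u => p u * Real.cos (u - x)) (x + s) := by
        simp
      rw [h0, intervalIntegral.integral_comp_add_left (fun u => p u * Real.cos (u - x))]
      have h : Function.Periodic (fun u => p u * Real.cos (u - x)) (2 * Real.pi) := by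
        intro u
        have : u + 2 * Real.pi - x = (u - x) + 2 * Real.pi := by ring
        simp only [hper, this, Real.cos_add_two_pi]
      have := h.intervalIntegral_add_eq (x + -Real.pi) 0
      rw [zero_add] at this
      have h3 : x + -Real.pi + 2 * Real.pi = x + Real.pi := by ring
      rw [h3] at this
      rw [this, hA, hB, ← intervalIntegral.integral_mul_const,
        ← intervalIntegral.integral_mul_const, ← intervalIntegral.integral_add]
      · congr 1; ext u; rw [Real.cos_sub]; ring
      · apply Continuous.intervalIntegrable; fun_prop
      · apply Continuous.intervalIntegrable; fun_prop
    have e3 : (∫ s in (-Real.pi)..Real.pi,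
        ((s * Real.sin s + Real.cos s / 2 - 1) * (p (x + s) + p2 (x + s))
          - 2 * (p (x + s) * Real.cos s) + p (x + s))) = 2 * Real.pi * p (x + Real.pi) := by
      rw [intervalIntegral.integral_eq_sub_of_hasDerivAt
        (f := fun s => (s * Real.sin s + Real.cos s / 2 - 1) * p1 (x + s)
          - (Real.sin s / 2 + s * Real.cos s) * p (x + s))]
      · have h3 : x + Real.pi = x + -Real.pi + 2 * Real.pi := by ring
        rw [h3, hper, hper1]
        simp
        ring
      · intro s _
        have := ((aux_hk s).mul ((hd2 (x + s)).comp_const_add x s)).sub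
          ((aux_hk' s).mul ((hd1 (x + s)).comp_const_add x s))
        refine this.congr_deriv ?_
        ring
      · apply Continuous.intervalIntegrable; fun_prop
    rw [intervalIntegral.integral_add, intervalIntegral.integral_sub,
      intervalIntegral.integral_const_mul, e1, e2] at e3
    · linarith
    all_goals (apply Continuous.intervalIntegrable; fun_prop)
  have bound : ∀ x, |∫ s in (-Real.pi)..Real.pi,
      (s * Real.sin s + Real.cos s / 2 - 1) * (p (x + s) + p2 (x + s))|
      ≤ (M - m) / 2 * (Real.pi ^ 3 / 3 - 11 / 4 * Real.pi + Real.pi / 2) := by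
    intro x
    have e : (∫ s in (-Real.pi)..Real.pi,
      (s * Real.sin s + Real.cos s / 2 - 1) * (p (x + s) + p2 (x + s))) =
      ∫ s in (-Real.pi)..Real.pi,
      (s * Real.sin s + Real.cos s / 2 - 1) * (p (x + s) + p2 (x + s) - (M + m) / 2) := by
      have : ∀ s, (s * Real.sin s + Real.cos s / 2 - 1) * (p (x + s) + p2 (x + s) - (M + m) / 2)
        = (s * Real.sin s + Real.cos s / 2 - 1) * (p (x + s) + p2 (x + s)) -
          (s * Real.sin s + Real.cos s / 2 - 1) * ((M + m) / 2) := fun s => by ring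
      simp_rw [this]
      rw [intervalIntegral.integral_sub, intervalIntegral.integral_mul_const, aux_int_k]
      · ring
      all_goals (apply Continuous.intervalIntegrable; fun_prop)
    rw [e, ← aux_int_k2, ← intervalIntegral.integral_const_mul, ← Real.norm_eq_abs]
    apply intervalIntegral.norm_integral_le_of_norm_le (by linarith)
    · filter_upwards with s _
      rw [Real.norm_eq_abs, abs_mul, mul_comm]
      have h1 : |p (x + s) + p2 (x + s) - (M + m) / 2| ≤ (M - m) / 2 := by
        rw [abs_le]; constructor <;> linarith [hm (x + s), hM (x + s)]
      apply mul_le_mul h1 _ (abs_nonneg _) ((abs_nonneg _).trans h1)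
      rw [← sq_abs (s * Real.sin s + Real.cos s / 2 - 1)]
      nlinarith [sq_nonneg (|s * Real.sin s + Real.cos s / 2 - 1| - 1 / 2)]
    · apply Continuous.intervalIntegrable; fun_prop
  refine ⟨I / (2 * Real.pi), A / Real.pi, B / Real.pi, by positivity, fun θ => ?_⟩
  have hb := bound (θ - Real.pi)
  rw [key, sub_add_cancel, Real.cos_sub_pi, Real.sin_sub_pi] at hb
  have hMm : 0 ≤ M - m := by linarith [hm 0, hM 0]
  have e : 2 * Real.pi * p θ + 2 * (A * -Real.cos θ + B * -Real.sin θ) - I =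
    2 * Real.pi * (p θ - (A / Real.pi * Real.cos θ + B / Real.pi * Real.sin θ)
      - I / (2 * Real.pi)) := by
    field_simp; ring
  rw [e, abs_mul, abs_of_pos (by positivity : 0 < 2 * Real.pi)] at hb
  have h4 : (M - m) / 2 * (Real.pi ^ 3 / 3 - 11 / 4 * Real.pi + Real.pi / 2) ≤
      2 * Real.pi * ((M - m) / 2 * (27 / 50)) := by
    have : Real.pi ^ 2 ≤ 9.9225 := by nlinarith [Real.pi_lt_d2]
    have h5 : Real.pi ^ 3 / 3 - 11 / 4 * Real.pi + Real.pi / 2 ≤ 2 * Real.pi * (27 / 50) := by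
      nlinarith
    have := mul_le_mul_of_nonneg_left h5 (by linarith : 0 ≤ (M - m) / 2)
    linarith
  exact le_of_mul_le_mul_left (hb.trans h4) (by positivity)

theorem stmt18
    (p : ℝ → ℝ)
    (hp : ContDiff ℝ (⊤ : ℕ∞) p)
    (hper : ∀ θ : ℝ, p (θ + 2 * Real.pi) = p θ)
    (ρ : ℝ → ℝ)
    (hρdef : ρ = fun θ => p θ + iteratedDeriv 2 p θ)
    (hρpos : ∀ θ : ℝ, 0 < ρ θ)
    (Atilde : ℝ)
    (hAt : Atilde = (1 / 2) * ∫ θ in (0:ℝ)..(2 * Real.pi), (deriv p θ ^ 2 - iteratedDeriv 2 p θ ^ 2))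
    (ρβ : ℝ → ℝ)
    (hρβ : ρβ = fun θ => |deriv p θ + iteratedDeriv 3 p θ|)
    (ρM ρm : ℝ)
    (hρM : ρM = sSup (ρ '' Set.Icc (0:ℝ) (2 * Real.pi)))
    (hρm : ρm = sInf (ρ '' Set.Icc (0:ℝ) (2 * Real.pi)))
    (K : Set (EuclideanSpace ℝ (Fin 2)))
    (hK : K = {x | ∀ θ : ℝ, x 0 * Real.cos θ + x 1 * Real.sin θ ≤ p θ})
    (ρe ρi : ℝ)
    (hρe : ρe = sInf {r : ℝ | 0 ≤ r ∧ ∃ c, K ⊆ Metric.closedBall c r})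
    (hρi : ρi = sSup {r : ℝ | 0 ≤ r ∧ ∃ c, Metric.closedBall c r ⊆ K})
    (ε : ℝ) (hε : 0 ≤ ε ∧ ε ≤ 1 / 2) :
    2 * Real.pi * (ρe - ρi) ^ 2
        ≤ |Atilde| + ε * (∫ θ in (0:ℝ)..(2 * Real.pi), ρβ θ ^ 2)
          + Real.pi * (ρM - ρm) ^ 2 ∧
      (|Atilde| + ε * (∫ θ in (0:ℝ)..(2 * Real.pi), ρβ θ ^ 2)
          + Real.pi * (ρM - ρm) ^ 2 = 2 * Real.pi * (ρe - ρi) ^ 2 ↔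
        (∃ a₀ a₁ b₁ : ℝ, ∀ θ : ℝ, p θ = a₀ + a₁ * Real.cos θ + b₁ * Real.sin θ)) := by
  obtain ⟨hε0, -⟩ := hε
  have hpi := Real.pi_pos
  have i2 : iteratedDeriv 2 p = deriv (deriv p) := by
    rw [iteratedDeriv_succ, iteratedDeriv_one]
  have hd1 : ∀ x, HasDerivAt p (deriv p x) x := fun x =>
    (hp.differentiable (by simp) x).hasDerivAt
  have hp' : ContDiff ℝ (⊤ : ℕ∞) (deriv p) := (contDiff_infty_iff_deriv.1 hp).2
  have hp'' : ContDiff ℝ (⊤ : ℕ∞) (deriv (deriv p)) := (contDiff_infty_iff_deriv.1 hp').2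
  have hd2 : ∀ x, HasDerivAt (deriv p) (iteratedDeriv 2 p x) x := fun x => by
    rw [i2]; exact (hp'.differentiable (by simp) x).hasDerivAt
  have hc2 : Continuous (iteratedDeriv 2 p) := by rw [i2]; exact hp''.continuous
  have hcρ : Continuous ρ := by rw [hρdef]; exact hp.continuous.add hc2
  have hperf : (fun x => p (x + 2 * Real.pi)) = p := funext hper
  have hρper : Function.Periodic ρ (2 * Real.pi) := by
    intro x
    have h1 : ∀ f : ℝ → ℝ, (fun x => f (x + 2 * Real.pi)) = f →
        (fun x => deriv f (x + 2 * Real.pi)) = deriv f := by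
      intro f hf
      ext x
      rw [← deriv_comp_add_const, hf]
    have h2 := congrFun (h1 _ (h1 _ hperf)) x
    simp only [hρdef, i2]
    rw [hper]
    rw [h2]
  have hcomp : IsCompact (ρ '' Set.Icc (0:ℝ) (2 * Real.pi)) := isCompact_Icc.image hcρ
  have hmem : ∀ x, ρ x ∈ ρ '' Set.Icc (0:ℝ) (2 * Real.pi) := by
    intro x
    obtain ⟨y, hy, hxy⟩ := hρper.exists_mem_Ico₀ (by positivity) x
    exact ⟨y, ⟨hy.1, hy.2.le⟩, hxy.symm⟩
  have hM : ∀ x, ρ x ≤ ρM := fun x => by rw [hρM]; exact le_csSup hcomp.bddAbove (hmem x)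
  have hm : ∀ x, ρm ≤ ρ x := fun x => by rw [hρm]; exact csInf_le hcomp.bddBelow (hmem x)
  have hD : 0 ≤ ρM - ρm := by linarith [hM 0, hm 0]
  have hρx : ∀ x, ρ x = p x + iteratedDeriv 2 p x := fun x => by rw [hρdef]
  obtain ⟨a0, a, b, ha0, hab⟩ := aux_main_s18 p (deriv p) (iteratedDeriv 2 p) hd1 hd2 hc2 hper ρm ρM
    (fun x => hρx x ▸ hm x) (fun x => hρx x ▸ hM x) (fun x => hρx x ▸ hρpos x)
  obtain ⟨g1, g2⟩ := aux_geom p K hK ρe ρi hρe hρi a b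
    (a0 - (ρM - ρm) / 2 * (27 / 50)) (a0 + (ρM - ρm) / 2 * (27 / 50)) (by positivity)
    (fun θ => by linarith [(abs_le.1 (hab θ)).2]) (fun θ => by linarith [(abs_le.1 (hab θ)).1])
  have hsq : (ρe - ρi) ^ 2 ≤ (27 / 50 * (ρM - ρm)) ^ 2 :=
    pow_le_pow_left₀ g1 (by linarith) 2
  have hint : 0 ≤ ε * (∫ θ in (0:ℝ)..(2 * Real.pi), ρβ θ ^ 2) :=
    mul_nonneg hε0 (intervalIntegral.integral_nonneg (by positivity) fun x _ => sq_nonneg _)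
  have hA := abs_nonneg Atilde
  have hmain : 2 * Real.pi * (ρe - ρi) ^ 2 ≤ Real.pi * (6 / 10 * (ρM - ρm) ^ 2) := by
    have := mul_le_mul_of_nonneg_left hsq hpi.le
    nlinarith [mul_nonneg hpi.le (sq_nonneg (ρM - ρm))]
  have hnn := mul_nonneg hpi.le (sq_nonneg (ρM - ρm))
  refine ⟨by linarith, ?_, ?_⟩
  · intro heq
    have h0 : Real.pi * (ρM - ρm) ^ 2 = 0 := by linarith
    have hD0 : ρM - ρm = 0 := by
      rcases mul_eq_zero.1 h0 with h | h
      · exact absurd h hpi.ne'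
      · exact pow_eq_zero_iff (two_ne_zero) |>.1 h
    refine ⟨a0, a, b, fun θ => ?_⟩
    have := hab θ
    rw [hD0] at this
    have := abs_le.1 this
    linarith [this.1, this.2]
  · rintro ⟨a₀, a₁, b₁, h⟩
    have e1 : deriv p = fun θ => -a₁ * Real.sin θ + b₁ * Real.cos θ := by
      ext θ
      rw [funext h]
      refine HasDerivAt.deriv ?_
      have := (((Real.hasDerivAt_cos θ).const_mul a₁).const_add a₀).add
        ((Real.hasDerivAt_sin θ).const_mul b₁)
      refine this.congr_deriv ?_
      ring
    have e2 : iteratedDeriv 2 p = fun θ => -a₁ * Real.cos θ - b₁ * Real.sin θ := by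
      ext θ
      rw [i2, e1]
      refine HasDerivAt.deriv ?_
      have := ((Real.hasDerivAt_sin θ).const_mul (-a₁)).add
        ((Real.hasDerivAt_cos θ).const_mul b₁)
      refine this.congr_deriv ?_
      ring
    have e3 : iteratedDeriv 3 p = fun θ => a₁ * Real.sin θ - b₁ * Real.cos θ := by
      ext θ
      rw [iteratedDeriv_succ, e2]
      refine HasDerivAt.deriv ?_
      have := ((Real.hasDerivAt_cos θ).const_mul (-a₁)).sub
        ((Real.hasDerivAt_sin θ).const_mul b₁)
      refine this.congr_deriv ?_
      ring
    have hβ0 : ∀ θ, ρβ θ = 0 := by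
      intro θ
      rw [hρβ, e1, e3]
      simp only [abs_eq_zero]
      ring
    have hρc : ρ = fun _ => a₀ := by
      ext θ
      rw [hρx, h, e2]; ring
    have himg : ρ '' Set.Icc (0:ℝ) (2 * Real.pi) = {a₀} := by
      rw [hρc]
      exact Set.Nonempty.image_const (Set.nonempty_Icc.2 (by positivity)) a₀
    have hD0 : ρM - ρm = 0 := by
      rw [hρM, hρm, himg, csSup_singleton, csInf_singleton, sub_self]
    have hA0 : Atilde = 0 := by
      rw [hAt, e1, e2]
      rw [intervalIntegral.integral_eq_sub_of_hasDerivAt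
        (f := fun θ => (b₁ ^ 2 - a₁ ^ 2) * (Real.sin θ * Real.cos θ) - 2 * a₁ * b₁ * Real.sin θ ^ 2)]
      · simp
      · intro θ _
        have := (((Real.hasDerivAt_sin θ).mul (Real.hasDerivAt_cos θ)).const_mul
          (b₁ ^ 2 - a₁ ^ 2)).sub (((Real.hasDerivAt_sin θ).pow 2).const_mul (2 * a₁ * b₁))
        refine this.congr_deriv ?_
        simp
        ring
      · apply Continuous.intervalIntegrable; fun_prop
    have he0 : ρe - ρi = 0 := by
      rw [hD0] at g2
      linarith
    simp [hA0, hD0, he0, hβ0]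
end
end
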